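/- Let λ = 6 + 2√5, let W > 0 be a real number, let s ≥ 0 be a real number, and let h : I → ℝ be a family of nonnegative reals indexed by a finite type I such that h(i) ≤ W/2 for every i ∈ I and s + Σ_{i ∈ I} h(i) = W. Then there exists a partition of I into two (possibly empty) sets I_A and I_B such that (Σ_{i ∈ I_A} h(i) + s) · (Σ_{i ∈ I_B} h(i) + s) ≥ W²/λ. -/

import Mathlib

/-- Let `λ = 6 + 2√5`, `W > 0`, `s ≥ 0`, and let `h : I → ℝ` be a family of
nonnegative reals over a finite index type `I` with `h i ≤ W/2` for all `i` and
`s + Σ_i h i = W`. Then `I` can be partitioned into two (possibly empty) parts `A` and `Aᶜ`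
such that `(Σ_{i ∈ A} h i + s) · (Σ_{i ∈ Aᶜ} h i + s) ≥ W²/λ`. -/
theorem exists_partition_weight_product_ge {I : Type*} [Fintype I] [DecidableEq I]
    (W s : ℝ) (hW : 0 < W) (hs : 0 ≤ s)
    (h : I → ℝ) (hh0 : ∀ i, 0 ≤ h i) (hhW : ∀ i, h i ≤ W / 2)
    (hsum : s + ∑ i, h i = W) :
    ∃ A : Finset I,
      (∑ i ∈ A, h i + s) * (∑ i ∈ Aᶜ, h i + s) ≥ W ^ 2 / (6 + 2 * Real.sqrt 5) := by
  obtain ⟨A, hA_lower, hA_upper⟩ : ∃ A : Finset I, (W - s) / 3 ≤ ∑ i ∈ A, h i ∧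
      ∑ i ∈ A, h i ≤ 2 * W / 3 := by
    by_cases hbig : ∃ i, (W - s) / 3 ≤ h i
    · obtain ⟨i, hi⟩ := hbig
      refine ⟨{i}, by simpa using hi, ?_⟩
      rw [Finset.sum_singleton]
      linarith [hhW i]
    · push Not at hbig
      have hsum_nonneg := Finset.sum_nonneg fun i (_ : i ∈ Finset.univ) => hh0 i
      obtain ⟨A, hA⟩ := exists_minimal_of_wellFoundedLT
        (fun A : Finset I => (W - s) / 3 ≤ ∑ i ∈ A, h i)
        ⟨Finset.univ, by linarith⟩
      refine ⟨A, hA.prop, ?_⟩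
      rcases A.eq_empty_or_nonempty with rfl | ⟨i, hi⟩
      · rw [Finset.sum_empty]
        positivity
      · have herase : ∑ j ∈ A.erase i, h j < (W - s) / 3 :=
          not_le.mp (hA.not_prop_of_lt (Finset.erase_ssubset hi))
        linarith [Finset.add_sum_erase A h hi, hbig i]
  have hcompl := Finset.sum_add_sum_compl A h
  have hA : W / 3 ≤ ∑ i ∈ A, h i + s := by linarith
  have hAc : W / 3 ≤ ∑ i ∈ Aᶜ, h i + s := by linarith
  have hsqrt : 3 / 2 ≤ Real.sqrt 5 := Real.le_sqrt_of_sq_le (by norm_num)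
  refine ⟨A, ?_⟩
  calc W ^ 2 / (6 + 2 * Real.sqrt 5) ≤ W ^ 2 / 9 := by gcongr; linarith
    _ = W / 3 * (W / 3) := by ring
    _ ≤ (∑ i ∈ A, h i + s) * (∑ i ∈ Aᶜ, h i + s) :=
      mul_le_mul hA hAc (by positivity) (by linarith)
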